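/- Let R be a ring and let (P₀⁽ˢ⁾, P₁⁽ˢ⁾, d_P⁽ˢ⁾, ∂₀⁽ˢ⁾, ∂₁⁽ˢ⁾, h_P⁽ˢ⁾) and (Q₀⁽ˢ⁾, Q₁⁽ˢ⁾, d_Q⁽ˢ⁾, δ₀⁽ˢ⁾, δ₁⁽ˢ⁾, h_Q⁽ˢ⁾) be two secondary chain complexes of R-modules. Suppose given R-linear maps f₀⁽ˢ⁾ : P₀⁽ˢ⁾ → Q₀⁽ˢ⁾, f₁⁽ˢ⁾ : P₁⁽ˢ⁾ → Q₁⁽ˢ⁾, and H⁽ˢ⁾ : P₀⁽ˢ⁾ → Q₁⁽ˢ⁻¹⁾ (s ≥ 1) satisfying: (a) d_Q⁽ˢ⁾ ∘ f₁⁽ˢ⁾ = f₀⁽ˢ⁾ ∘ d_P⁽ˢ⁾; (b) H⁽ˢ⁾ ∘ d_P⁽ˢ⁾ = f₁⁽ˢ⁻¹⁾ ∘ ∂₁⁽ˢ⁾ − δ₁⁽ˢ⁾ ∘ f₁⁽ˢ⁾; (c) d_Q⁽ˢ⁻¹⁾ ∘ H⁽ˢ⁾ = f₀⁽ˢ⁻¹⁾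 ∘ ∂₀⁽ˢ⁾ − δ₀⁽ˢ⁾ ∘ f₀⁽ˢ⁾; (d) δ₁⁽ˢ⁻¹⁾ ∘ H⁽ˢ⁾ + H⁽ˢ⁻¹⁾ ∘ ∂₀⁽ˢ⁾ = f₁⁽ˢ⁻²⁾ ∘ h_P⁽ˢ⁾ − h_Q⁽ˢ⁾ ∘ f₀⁽ˢ⁾. Then the maps Fₛ : P₀⁽ˢ⁾ ⊕ P₁⁽ˢ⁻¹⁾ → Q₀⁽ˢ⁾ ⊕ Q₁⁽ˢ⁻¹⁾ given by Fₛ(x, y) = (f₀⁽ˢ⁾x, H⁽ˢ⁾x + f₁⁽ˢ⁻¹⁾y) (and F₀ = f₀⁽⁰⁾) form a chain map between the totalizations, i.e., Fₛ₋₁ ∘ Dₛ^P = Dₛ^Q ∘ Fₛ for all s ≥ 1. -/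

import Mathlib

/-- **A secondary chain map induces a chain map of totalizations.**

Given two secondary chain complexes `(P₀, P₁, d_P, ∂₀, ∂₁, h_P)` and
`(Q₀, Q₁, d_Q, δ₀, δ₁, h_Q)` of `R`-modules (axioms (i)–(iv) for each, stated with
the reindexing `∂ᵢ s : Pᵢ (s+1) → Pᵢ s`, `h s : P₀ (s+2) → P₁ s`), together with maps
`f₀⁽ˢ⁾, f₁⁽ˢ⁾` and homotopies `H⁽ˢ⁾ : P₀⁽ˢ⁾ → Q₁⁽ˢ⁻¹⁾` (reindexed as
`H s : P₀ (s+1) → Q₁ s`) satisfying (a)–(d), the maps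
`Fₛ(x, y) = (f₀x, Hx + f₁y)` (and `F₀ = f₀⁽⁰⁾`) commute with the total differentials
`Dₛ(x, y) = (∂₀x + dy, −hx − ∂₁y)` (`s ≥ 2`), `D₁(x, y) = ∂₀x + dy`:
`Fₛ₋₁ ∘ Dₛ^P = Dₛ^Q ∘ Fₛ` for all `s ≥ 1`.  The first conjunct is the case `s = 1`,
the second the cases `s ≥ 2` (both components stated). -/
theorem secondary_chain_map_total
    {R : Type*} [Ring R] (P0 P1 Q0 Q1 : ℕ → Type*)
    [∀ s, AddCommGroup (P0 s)] [∀ s, AddCommGroup (P1 s)]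
    [∀ s, Module R (P0 s)] [∀ s, Module R (P1 s)]
    [∀ s, AddCommGroup (Q0 s)] [∀ s, AddCommGroup (Q1 s)]
    [∀ s, Module R (Q0 s)] [∀ s, Module R (Q1 s)]
    (dP : ∀ s, P1 s →ₗ[R] P0 s)
    (del0 : ∀ s, P0 (s + 1) →ₗ[R] P0 s)
    (del1 : ∀ s, P1 (s + 1) →ₗ[R] P1 s)
    (hP : ∀ s, P0 (s + 2) →ₗ[R] P1 s)
    (dQ : ∀ s, Q1 s →ₗ[R] Q0 s)
    (delta0 : ∀ s, Q0 (s + 1) →ₗ[R] Q0 s)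
    (delta1 : ∀ s, Q1 (s + 1) →ₗ[R] Q1 s)
    (hQ : ∀ s, Q0 (s + 2) →ₗ[R] Q1 s)
    -- P is a secondary chain complex
    (hchainP : ∀ s, (dP s).comp (del1 s) = (del0 s).comp (dP (s + 1)))
    (hnull0P : ∀ s, (del0 s).comp (del0 (s + 1)) = (dP s).comp (hP s))
    (hnull1P : ∀ s, (del1 s).comp (del1 (s + 1)) = (hP s).comp (dP (s + 2)))
    (hmasseyP : ∀ s, (hP s).comp (del0 (s + 2)) = (del1 s).comp (hP (s + 1)))
    -- Q is a secondary chain complex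
    (hchainQ : ∀ s, (dQ s).comp (delta1 s) = (delta0 s).comp (dQ (s + 1)))
    (hnull0Q : ∀ s, (delta0 s).comp (delta0 (s + 1)) = (dQ s).comp (hQ s))
    (hnull1Q : ∀ s, (delta1 s).comp (delta1 (s + 1)) = (hQ s).comp (dQ (s + 2)))
    (hmasseyQ : ∀ s, (hQ s).comp (delta0 (s + 2)) = (delta1 s).comp (hQ (s + 1)))
    -- the secondary chain map data
    (f0 : ∀ s, P0 s →ₗ[R] Q0 s)
    (f1 : ∀ s, P1 s →ₗ[R] Q1 s)
    (H : ∀ s, P0 (s + 1) →ₗ[R] Q1 s)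
    -- (a) f commutes with the internal differentials
    (ha : ∀ s, (dQ s).comp (f1 s) = (f0 s).comp (dP s))
    -- (b) H ∘ d_P = f₁ ∘ ∂₁ − δ₁ ∘ f₁
    (hb : ∀ s, (H s).comp (dP (s + 1)) =
      (f1 s).comp (del1 s) - (delta1 s).comp (f1 (s + 1)))
    -- (c) d_Q ∘ H = f₀ ∘ ∂₀ − δ₀ ∘ f₀
    (hc : ∀ s, (dQ s).comp (H s) =
      (f0 s).comp (del0 s) - (delta0 s).comp (f0 (s + 1)))
    -- (d) δ₁ ∘ H + H ∘ ∂₀ = f₁ ∘ h_P − h_Q ∘ f₀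
    (hd : ∀ s, (delta1 s).comp (H (s + 1)) + (H s).comp (del0 (s + 1)) =
      (f1 s).comp (hP s) - (hQ s).comp (f0 (s + 2))) :
    -- F is a chain map between the totalizations
    (∀ (x : P0 1) (y : P1 0),
      f0 0 (del0 0 x + dP 0 y) =
        delta0 0 (f0 1 x) + dQ 0 (H 0 x + f1 0 y)) ∧
    (∀ (s : ℕ) (x : P0 (s + 2)) (y : P1 (s + 1)),
      f0 (s + 1) (del0 (s + 1) x + dP (s + 1) y) =
        delta0 (s + 1) (f0 (s + 2) x) + dQ (s + 1) (H (s + 1) x + f1 (s + 1) y) ∧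
      H s (del0 (s + 1) x + dP (s + 1) y) + f1 s (-(hP s x) - del1 s y) =
        -(hQ s (f0 (s + 2) x)) - delta1 s (H (s + 1) x + f1 (s + 1) y)) := by
  have ha' s y : dQ s (f1 s y) = f0 s (dP s y) := LinearMap.congr_fun (ha s) y
  have hb' s y : H s (dP (s + 1) y) = f1 s (del1 s y) - delta1 s (f1 (s + 1) y) :=
    LinearMap.congr_fun (hb s) y
  have hc' s x : dQ s (H s x) = f0 s (del0 s x) - delta0 s (f0 (s + 1) x) :=
    LinearMap.congr_fun (hc s) x
  have hd' s x : delta1 s (H (s + 1) x) + H s (del0 (s + 1) x) =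
      f1 s (hP s x) - hQ s (f0 (s + 2) x) := LinearMap.congr_fun (hd s) x
  have fst_component s (x : P0 (s + 1)) (y : P1 s) : f0 s (del0 s x + dP s y) =
      delta0 s (f0 (s + 1) x) + dQ s (H s x + f1 s y) := by
    rw [map_add, map_add, ha', hc']
    abel
  refine ⟨fst_component 0, fun s x y => ⟨fst_component (s + 1) x y, ?_⟩⟩
  rw [map_add, map_add, map_sub, map_neg, hb', eq_sub_of_add_eq' (hd' s x)]
  abel
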